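/- arXiv:2001.04436 — 2 statements merged into one kernel-verified Lean document; each statement's English description precedes it below -/
import Mathlib

section
/- Let n and t be positive integers with n/2 ≤ t < n. Let F be a finite field and K an extension field of F such that K = F(α_1, …, α_{n+2t−2}) for elements α_1, …, α_{n+2t−2} ∈ K satisfying α_i ∉ F(α_1, …, α_{i−1}) for every i. Then there exist 2t linearly independent vectors v_1, …, v_{2t} ∈ K^{2n} satisfying: (a) writing D = (v_1, …, v_{2t}) ∈ K^{2n×2t} for the matrix with columns v_1,…,v_{2t} and w_1, …, w_{2n} ∈ K^{2t} for its rows, for every permutation π of {1, …, n} the 2t rows w_{π(1)}, …, w_{π(t)}, w_{n+π(1)}, …, w_{n+π(t)} are linearly independent over K; and (b) v_iᵀ J v_j = 0 for every i ∈ {1, …, 2n−2t} and every j ∈ {1, …, 2t}, where J is the 2n×2n block matrix [[0, −I_n],[I_n, 0]] over K. -/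
open Finset in
/-- The Lagrange weights of `n` nodes annihilate all monomials of degree less than `n - 1`. -/
theorem Lagrange.sum_nodalWeight_mul_pow_eq_zero {ι K : Type*} [DecidableEq ι] [Field K]
    {s : Finset ι} {x : ι → K} (hx : Set.InjOn x s) {m : ℕ} (hm : m + 1 < #s) :
    ∑ i ∈ s, Lagrange.nodalWeight s x i * x i ^ m = 0 := by
  have hdeg : (Polynomial.X ^ m : Polynomial K).degree < #s := by
    rw [Polynomial.degree_X_pow]
    exact_mod_cast (by omega : m < #s)
  have h := Lagrange.coeff_eq_sum hx hdeg
  rw [Polynomial.coeff_X_pow, if_neg (by omega)] at h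
  rw [h]
  refine sum_congr rfl fun i _ => ?_
  simp [Lagrange.nodalWeight, div_eq_mul_inv, mul_comm]

/-- The product code of two generalized Reed-Solomon codes on the nodes `x`, the first with
trivial weights and the second with weights `w`: its generators, in the order `(x ^ 0, 0)`,
`(0, w x ^ 0)`, `(x ^ 1, 0)`, `(0, w x ^ 1)`, and so on. -/
def reedSolomonPair {ι K : Type*} [Field K] (x w : ι → K) (j : ℕ) : ι ⊕ ι → K :=
  if j % 2 = 0 then Sum.elim (fun s => x s ^ (j / 2)) 0
  else Sum.elim 0 (fun s => w s * x s ^ (j / 2))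

section reedSolomonPair

variable {ι K : Type*} [Field K] (x w : ι → K) (k : ℕ) (s : ι)

@[simp]
theorem reedSolomonPair_even_inl : reedSolomonPair x w (2 * k) (Sum.inl s) = x s ^ k := by
  simp [reedSolomonPair]

@[simp]
theorem reedSolomonPair_even_inr : reedSolomonPair x w (2 * k) (Sum.inr s) = 0 := by
  simp [reedSolomonPair]

@[simp]
theorem reedSolomonPair_odd_inl : reedSolomonPair x w (2 * k + 1) (Sum.inl s) = 0 := by
  simp [reedSolomonPair]

@[simp]
theorem reedSolomonPair_odd_inr :
    reedSolomonPair x w (2 * k + 1) (Sum.inr s) = w s * x s ^ k := by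
  have h : (2 * k + 1) / 2 = k := by omega
  simp [reedSolomonPair, h]

variable {x w} {t : ℕ} {c : Fin t → ι}

/-- Any `t` pairs of coordinates form an information set of `reedSolomonPair`. -/
theorem linearIndependent_reedSolomonPair_rows (hx : Function.Injective x) (hw : ∀ i, w i ≠ 0)
    (hc : Function.Injective c) :
    LinearIndependent K fun (i : Fin t ⊕ Fin t) (j : Fin (2 * t)) =>
      reedSolomonPair x w j (Sum.map c c i) := by
  rw [Fintype.linearIndependent_iff]
  intro g hg
  have hl : (fun a => g (Sum.inl a)) = 0 := by
    refine Matrix.eq_zero_of_forall_pow_sum_mul_pow_eq_zero (hx.comp hc) fun k => ?_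
    simpa using congrFun hg ⟨2 * k, by omega⟩
  have hr : (fun a => g (Sum.inr a) * w (c a)) = 0 := by
    refine Matrix.eq_zero_of_forall_pow_sum_mul_pow_eq_zero (hx.comp hc) fun k => ?_
    simpa [mul_assoc] using congrFun hg ⟨2 * k + 1, by omega⟩
  rintro (a | a)
  · exact congrFun hl a
  · simpa [hw] using congrFun hr a

theorem linearIndependent_reedSolomonPair (hx : Function.Injective x) (hw : ∀ i, w i ≠ 0)
    (hc : Function.Injective c) :
    LinearIndependent K fun j : Fin (2 * t) => reedSolomonPair x w j := by
  let e : Fin t × Fin 2 ≃ Fin (2 * t) := finProdFinEquiv.trans (finCongr (mul_comm t 2))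
  have he : ∀ p, (e p : ℕ) = 2 * p.1 + p.2 := fun p => by simp [e, add_comm]
  rw [← linearIndependent_equiv e, Fintype.linearIndependent_iff]
  intro g hg
  have hl : (fun k => g (k, 0)) = 0 := by
    refine Matrix.eq_zero_of_forall_index_sum_mul_pow_eq_zero (hx.comp hc) fun a => ?_
    simpa [he, Fintype.sum_prod_type] using congrFun hg (Sum.inl (c a))
  have hr : (fun k => g (k, 1)) = 0 := by
    refine Matrix.eq_zero_of_forall_index_sum_mul_pow_eq_zero (hx.comp hc) fun a => ?_
    have h := congrFun hg (Sum.inr (c a))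
    simp only [Finset.sum_apply, Function.comp_apply, Pi.smul_apply, he, Fintype.sum_prod_type,
      Fin.sum_univ_two, Fin.val_zero, Fin.val_one, add_zero, reedSolomonPair_even_inr,
      reedSolomonPair_odd_inr, smul_eq_mul, mul_zero, zero_add, mul_left_comm _ (w (c a)),
      ← Finset.mul_sum, Pi.zero_apply, mul_eq_zero, hw, false_or] at h
    exact h
  rintro ⟨k, b⟩
  fin_cases b
  · exact congrFun hl k
  · exact congrFun hr k

theorem reedSolomonPair_symplectic_eq_zero [Fintype ι] {N : ℕ}
    (h : ∀ m ≤ N, ∑ s, w s * x s ^ m = 0) {i j : ℕ} (hij : i / 2 + j / 2 ≤ N) :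
    (∑ s, reedSolomonPair x w i (Sum.inr s) * reedSolomonPair x w j (Sum.inl s))
      - (∑ s, reedSolomonPair x w i (Sum.inl s) * reedSolomonPair x w j (Sum.inr s)) = 0 := by
  have h' := h _ hij
  simp only [pow_add] at h'
  obtain hi | hi := Nat.mod_two_eq_zero_or_one i <;> obtain hj | hj := Nat.mod_two_eq_zero_or_one j
  · simp [reedSolomonPair, hi, hj]
  · simpa [reedSolomonPair, hi, hj, mul_left_comm] using h'
  · simpa [reedSolomonPair, hi, hj, mul_assoc] using h'
  · simp [reedSolomonPair, hi, hj]

end reedSolomonPair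

/-- Lemma 3 of the paper: Let `n, t` be positive integers with
`n/2 ≤ t < n` (i.e. `n ≤ 2t` and `t < n`).  Let `K = F(α_1, …, α_{n+2t-2})` be a field
extension of `F` with `α_i ∉ F(α_1, …, α_{i-1})` for every `i`.  Then there exist `2t`
linearly independent vectors `v_1, …, v_{2t} ∈ K^{2n}` (coordinates indexed by
`Fin n ⊕ Fin n`, the first block being the top `n` coordinates) such that:
(a) for every permutation `π` of `{1,…,n}`, the `2t` rows
`w_{π(1)}, …, w_{π(t)}, w_{n+π(1)}, …, w_{n+π(t)}` of the matrix `D = (v_1 … v_{2t})`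
are linearly independent (the row `w_m` is `j ↦ v j m`); and
(b) `v_iᵀ J v_j = 0` for `i ∈ {1,…,2n−2t}` and `j ∈ {1,…,2t}`, where
`J = [[0, -I_n], [I_n, 0]]`, so that `v_iᵀ J v_j
  = ∑_s (v_i)_{n+s} (v_j)_s − ∑_s (v_i)_s (v_j)_{n+s}`. -/
theorem stmt_0 {F K : Type*} [Field F] [Field K] [Algebra F K]
    (n t : ℕ) (ht : 0 < t) (htn : t < n) (hnt : n ≤ 2 * t)
    (α : ℕ → K)
    (hα : ∀ i, 1 ≤ i → i ≤ n + 2 * t - 2 →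
      α i ∉ IntermediateField.adjoin F (α '' Set.Icc 1 (i - 1)))
    (htop : IntermediateField.adjoin F (α '' Set.Icc 1 (n + 2 * t - 2)) = ⊤) :
    ∃ v : Fin (2 * t) → (Fin n ⊕ Fin n → K),
      LinearIndependent K v ∧
      (∀ π : Equiv.Perm (Fin n),
        LinearIndependent K fun (i : Fin t ⊕ Fin t) (j : Fin (2 * t)) =>
          v j (Sum.map (fun a => π (Fin.castLE htn.le a))
            (fun a => π (Fin.castLE htn.le a)) i)) ∧
      (∀ i j : Fin (2 * t), (i : ℕ) < 2 * n - 2 * t →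
        (∑ s, v i (Sum.inr s) * v j (Sum.inl s))
          - (∑ s, v i (Sum.inl s) * v j (Sum.inr s)) = 0) := by
  classical
  let x : Fin n → K := fun i => α (i + 1)
  have hx : Function.Injective x := by
    refine .of_lt_imp_ne fun i j hij h => ?_
    refine hα (j + 1) (by omega) (by omega) ?_
    rw [← show α (i + 1) = α (j + 1) from h]
    exact IntermediateField.subset_adjoin _ _
      ⟨i + 1, ⟨by omega, by simpa [Nat.succ_le_iff] using hij⟩, rfl⟩
  let w : Fin n → K := Lagrange.nodalWeight Finset.univ x
  have hw : ∀ i, w i ≠ 0 := fun i =>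
    Lagrange.nodalWeight_ne_zero hx.injOn (Finset.mem_univ i)
  refine ⟨fun j => reedSolomonPair x w j,
    linearIndependent_reedSolomonPair hx hw (Fin.castLE_injective htn.le),
    fun π => linearIndependent_reedSolomonPair_rows hx hw
      (π.injective.comp (Fin.castLE_injective htn.le)),
    fun i j hi => reedSolomonPair_symplectic_eq_zero (N := n - 2) (fun m hm => ?_) (by omega)⟩
  exact Lagrange.sum_nodalWeight_mul_pow_eq_zero hx.injOn
    (by rw [Finset.card_univ, Fintype.card_fin]; omega)
end

section
/- Let V be a self-orthogonal d-dimensional F_q-subspace of F_q^{2n}, let c : V → ℂ with c(0) = 1 be such that W(v) := c(v)·W̃(v) satisfies W(v) W(v') = W(v+v') for all v, v' ∈ V, and let (P_{[w]})_{[w] ∈ F_q^{2n}/V^{⊥J}} be the family of mutually orthogonal projections summing to the identity with W(v) = ∑_{[w]} ω^{⟨v,Jw⟩} P_{[w]} for all v ∈ V. Then for every coset [w] ∈ F_q^{2n}/V^{⊥J}, the rank of P_{[w]} equals q^{n−d}. -/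
/-- `ω = exp(2πi/p)`, a primitive `p`-th root of unity. -/
noncomputable def omg (p : ℕ) : ℂ := Complex.exp (2 * (Real.pi : ℂ) * Complex.I / (p : ℂ))

/-- The `F_p`-valued pairing `⟨x, y⟩ = tr(∑ s, x s * y s)` on `F_q^n`, where
`tr : F_q → F_p` is the field trace. -/
noncomputable def ip (p : ℕ) {K : Type*} [Field K] [Fintype K] [Algebra (ZMod p) K]
    {n : ℕ} (x y : Fin n → K) : ZMod p :=
  Algebra.trace (ZMod p) K (∑ s, x s * y s)

/-- The Weyl operator `W̃(a,b)`: the `q^n × q^n` complex matrix, with rows and columns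
indexed by `F_q^n`, whose `(j,k)` entry is `ω^{⟨b,k⟩}` if `j = k + a` and `0`
otherwise. -/
noncomputable def Wt (p : ℕ) {K : Type*} [Field K] [Fintype K] [DecidableEq K]
    [Algebra (ZMod p) K] {n : ℕ} (a b : Fin n → K) :
    Matrix (Fin n → K) (Fin n → K) ℂ :=
  Matrix.of fun j k => if j = k + a then omg p ^ (ip p b k).val else 0

/-- The Weyl operator `W̃(v)` of a vector `v = (a,b) ∈ F_q^{2n} = F_q^n × F_q^n`. -/
noncomputable def Wtv (p : ℕ) {K : Type*} [Field K] [Fintype K] [DecidableEq K]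
    [Algebra (ZMod p) K] {n : ℕ} (v : (Fin n → K) × (Fin n → K)) :
    Matrix (Fin n → K) (Fin n → K) ℂ :=
  Wt p v.1 v.2

/-- The symplectic pairing `⟨v, Jw⟩ = ⟨v.2, w.1⟩ − ⟨v.1, w.2⟩ ∈ F_p` on
`F_q^{2n} = F_q^n × F_q^n`, where `J = [[0, −I_n],[I_n, 0]]`. -/
noncomputable def symp (p : ℕ) {K : Type*} [Field K] [Fintype K] [Algebra (ZMod p) K]
    {n : ℕ} (v w : (Fin n → K) × (Fin n → K)) : ZMod p :=
  ip p v.2 w.1 - ip p v.1 w.2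

lemma ip_add_right (p : ℕ) {K : Type*} [Field K] [Fintype K] [Algebra (ZMod p) K]
    {n : ℕ} (x y y' : Fin n → K) : ip p x (y + y') = ip p x y + ip p x y' := by
  unfold ip
  rw [← map_add]
  congr 1
  simp [mul_add, Finset.sum_add_distrib]

lemma ip_neg_right (p : ℕ) {K : Type*} [Field K] [Fintype K] [Algebra (ZMod p) K]
    {n : ℕ} (x y : Fin n → K) : ip p x (-y) = - ip p x y := by
  unfold ip
  rw [← map_neg]
  congr 1
  simp [mul_neg]

lemma ip_zero_right (p : ℕ) {K : Type*} [Field K] [Fintype K] [Algebra (ZMod p) K]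
    {n : ℕ} (x : Fin n → K) : ip p x 0 = 0 := by
  simp [ip]

/-- `V^{⊥J} = {w ∈ F_q^{2n} : ⟨v, Jw⟩ = 0 for all v ∈ V}`, as an additive subgroup of
`F_q^{2n}` (so that one can form the quotient `F_q^{2n} / V^{⊥J}`). -/
def sympPerp (p : ℕ) {K : Type*} [Field K] [Fintype K] [Algebra (ZMod p) K]
    {n : ℕ} (V : Submodule K ((Fin n → K) × (Fin n → K))) :
    AddSubgroup ((Fin n → K) × (Fin n → K)) where
  carrier := {w | ∀ v ∈ V, symp p v w = 0}
  zero_mem' := by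
    intro v _
    simp [symp, ip_zero_right]
  add_mem' := by
    intro w w' hw hw' v hv
    have h : symp p v (w + w') = symp p v w + symp p v w' := by
      simp only [symp, Prod.fst_add, Prod.snd_add, ip_add_right]
      ring
    rw [h, hw v hv, hw' v hv, add_zero]
  neg_mem' := by
    intro w hw v hv
    have h : symp p v (-w) = - symp p v w := by
      simp only [symp, Prod.fst_neg, Prod.snd_neg, ip_neg_right]
      ring
    rw [h, hw v hv, neg_zero]

lemma omg_pow_self (p : ℕ) [Fact p.Prime] : omg p ^ p = 1 :=
  (Complex.isPrimitiveRoot_exp p (Fact.out : p.Prime).ne_zero).pow_eq_one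

/-- The additive character `k ↦ ω^k` of `F_p`. -/
noncomputable def omgChar (p : ℕ) [Fact p.Prime] : AddChar (ZMod p) ℂ :=
  AddChar.zmodChar p (omg_pow_self p)

lemma omgChar_apply (p : ℕ) [Fact p.Prime] (a : ZMod p) : omgChar p a = omg p ^ a.val :=
  AddChar.zmodChar_apply _ a

lemma omgChar_eq_one_iff (p : ℕ) [Fact p.Prime] (a : ZMod p) : omgChar p a = 1 ↔ a = 0 := by
  refine ⟨fun h => ?_, fun h => by simp [h]⟩
  rw [omgChar_apply] at h
  have hprim : IsPrimitiveRoot (omg p) p :=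
    Complex.isPrimitiveRoot_exp p (Fact.out : p.Prime).ne_zero
  have hdvd := hprim.dvd_of_pow_eq_one _ h
  exact (ZMod.val_eq_zero a).1 (Nat.eq_zero_of_dvd_of_lt hdvd (ZMod.val_lt a))

lemma sum_omgChar_eq_zero (p : ℕ) [Fact p.Prime] {G : Type*} [AddCommGroup G] [Fintype G]
    {f : G →+ ZMod p} (hf : f ≠ 0) : ∑ g, omgChar p (f g) = 0 := by
  have h : (omgChar p).compAddMonoidHom f ≠ 0 := fun h => hf <| by
    ext g
    exact (omgChar_eq_one_iff p _).1 (by simpa using DFunLike.congr_fun h g)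
  simpa using AddChar.sum_eq_zero_iff_ne_zero.2 h

section Pairing

variable (p : ℕ) {K : Type*} [Field K] [Fintype K] [Algebra (ZMod p) K] {n : ℕ}

lemma ip_comm (x y : Fin n → K) : ip p x y = ip p y x := by
  simp only [ip, mul_comm]

lemma ip_add_left (x x' y : Fin n → K) : ip p (x + x') y = ip p x y + ip p x' y := by
  simp only [ip_comm p _ y, ip_add_right]

/-- The pairing with a fixed vector, as an additive map. -/
noncomputable def ipHom (x : Fin n → K) : (Fin n → K) →+ ZMod p where
  toFun := ip p x
  map_zero' := ip_zero_right p x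
  map_add' := ip_add_right p x

lemma ipHom_ne_zero [Fact p.Prime] {x : Fin n → K} (hx : x ≠ 0) : ipHom p x ≠ 0 := by
  obtain ⟨i, hi⟩ := Function.ne_iff.1 hx
  intro h
  apply Algebra.trace_ne_zero (ZMod p) K
  ext a
  have ha : ip p x (Pi.single i ((x i)⁻¹ * a)) = 0 := DFunLike.congr_fun h _
  simpa [ip, Pi.single_apply, mul_inv_cancel_left₀ hi] using ha

/-- The symplectic pairing with a fixed vector in the second argument, as an additive map
on a subspace. -/
noncomputable def sympHom (V : Submodule K ((Fin n → K) × (Fin n → K)))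
    (w : (Fin n → K) × (Fin n → K)) : V →+ ZMod p :=
  AddMonoidHom.mk' (fun v => symp p v w) fun v v' => by
    simp only [symp, Submodule.coe_add, Prod.fst_add, Prod.snd_add, ip_add_left]
    ring

lemma symp_sub_right (v w w' : (Fin n → K) × (Fin n → K)) :
    symp p v (w - w') = symp p v w - symp p v w' := by
  simp only [symp, sub_eq_add_neg, Prod.fst_add, Prod.snd_add, Prod.fst_neg, Prod.snd_neg,
    ip_add_right, ip_neg_right]
  ring

lemma trace_Wtv [Fact p.Prime] [DecidableEq K] (v : (Fin n → K) × (Fin n → K)) :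
    (Wtv p v).trace = if v = 0 then (Fintype.card K : ℂ) ^ n else 0 := by
  obtain ⟨a, b⟩ := v
  simp only [Matrix.trace, Matrix.diag_apply, Wtv, Wt, Matrix.of_apply, left_eq_add,
    ← omgChar_apply, Prod.mk_eq_zero]
  by_cases ha : a = 0
  · by_cases hb : b = 0
    · simp [ha, hb, ip]
    · simpa [ha, hb, ipHom] using sum_omgChar_eq_zero p (ipHom_ne_zero p hb)
  · simp [ha]

end Pairing

lemma Matrix.trace_eq_rank_of_isIdempotentElem {ι : Type*} [Fintype ι] [DecidableEq ι]
    {F : Type*} [Field F] {A : Matrix ι ι F} (hA : IsIdempotentElem A) : A.trace = A.rank := by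
  have h : IsIdempotentElem (Matrix.toLin' A) := by
    rw [IsIdempotentElem, Module.End.mul_eq_comp, ← Matrix.toLin'_mul, hA]
  rw [← Matrix.trace_toLin'_eq, (LinearMap.IsIdempotentElem.isProj_range _ h).trace]
  rfl

/-- Proposition 2, part 3, of the paper: with `V` a self-orthogonal
`d`-dimensional subspace of `F_q^{2n}`, `c`, and the family of projections
`(P_{[w]})` as in Proposition 2, every projection `P_{[w]}` has rank `q^{n-d}`. -/
theorem stmt_14 (p : ℕ) [Fact p.Prime] (K : Type*) [Field K] [Fintype K] [DecidableEq K]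
    [Algebra (ZMod p) K] (n d : ℕ)
    (V : Submodule K ((Fin n → K) × (Fin n → K)))
    (hd : Module.finrank K V = d)
    (hV : ∀ v ∈ V, ∀ v' ∈ V, symp p v v' = 0)
    (c : ((Fin n → K) × (Fin n → K)) → ℂ) (hc0 : c 0 = 1)
    (hmul : ∀ v ∈ V, ∀ v' ∈ V,
      (c v • Wtv p v) * (c v' • Wtv p v') = c (v + v') • Wtv p (v + v'))
    (P : (((Fin n → K) × (Fin n → K)) ⧸ sympPerp p V) →
      Matrix (Fin n → K) (Fin n → K) ℂ)
    (hproj : ∀ x, (P x).conjTranspose = P x ∧ P x * P x = P x)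
    (horth : ∀ x y, x ≠ y → P x * P y = 0)
    (hsum : (∑ᶠ x, P x) = 1)
    (hdec : ∀ v ∈ V, c v • Wtv p v = ∑ᶠ x, omg p ^ (symp p v x.out).val • P x) :
    ∀ x : ((Fin n → K) × (Fin n → K)) ⧸ sympPerp p V,
      (P x).rank = Fintype.card K ^ (n - d) := by
  classical
  intro x
  have : Fintype (((Fin n → K) × (Fin n → K)) ⧸ sympPerp p V) := Fintype.ofFinite _
  have : Fintype V := Fintype.ofFinite V
  have hchar (y : ((Fin n → K) × (Fin n → K)) ⧸ sympPerp p V) : ∑ v : V, omgChar p (-symp p v x.out) * omgChar p (symp p v y.out) =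
      if y = x then (Fintype.card V : ℂ) else 0 := by
    simp_rw [← AddChar.map_add_eq_mul, neg_add_eq_sub, ← symp_sub_right]
    split_ifs with h
    · simp [h, symp, ip]
    · refine sum_omgChar_eq_zero p (f := sympHom p V (y.out - x.out)) fun h0 => h ?_
      rw [← QuotientAddGroup.out_eq' y, ← QuotientAddGroup.out_eq' x]
      refine (QuotientAddGroup.eq.2 ?_).symm
      rw [neg_add_eq_sub]
      exact fun v hv => DFunLike.congr_fun h0 ⟨v, hv⟩
  have htr (v : V) : c v * (Wtv p (v : (Fin n → K) × (Fin n → K))).trace =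
      ∑ y, omgChar p (symp p v y.out) * (P y).trace := by
    have h := congrArg Matrix.trace (hdec v v.2)
    rw [finsum_eq_sum_of_fintype] at h
    simpa [Matrix.trace_sum, Matrix.trace_smul, ← omgChar_apply] using h
  have hcount : (Fintype.card V : ℂ) * (P x).trace = (Fintype.card K : ℂ) ^ n := by
    calc (Fintype.card V : ℂ) * (P x).trace
        = ∑ y, (∑ v : V, omgChar p (-symp p v x.out) * omgChar p (symp p v y.out)) *
            (P y).trace := by simp [hchar, ite_mul]
      _ = ∑ v : V, omgChar p (-symp p v x.out) *
            (c v * (Wtv p (v : (Fin n → K) × (Fin n → K))).trace) := by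
          simp_rw [htr, Finset.sum_mul, Finset.mul_sum, mul_assoc]
          exact Finset.sum_comm
      _ = (Fintype.card K : ℂ) ^ n := by
          rw [Finset.sum_eq_single 0]
          · simp [trace_Wtv, hc0, symp, ip]
          · intro v _ hv
            simp [trace_Wtv, hv]
          · simp
  rw [Matrix.trace_eq_rank_of_isIdempotentElem (hproj x).2,
    Module.card_eq_pow_finrank (K := K) (V := V), hd] at hcount
  have hnat : Fintype.card K ^ d * (P x).rank = Fintype.card K ^ n := by exact_mod_cast hcount
  have hdn : d ≤ n := (Nat.pow_dvd_pow_iff_le_right Fintype.one_lt_card).1 ⟨_, hnat.symm⟩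
  refine Nat.eq_of_mul_eq_mul_left (pow_pos (Fintype.card_pos (α := K)) d) ?_
  rw [hnat, ← pow_add, Nat.add_sub_cancel' hdn]
end
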